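/- Let A be a set with |A| > ω, B ⊆ A, and let Z and F be closed subsets of ℝ^A × ℝ^A. Suppose f, g : ℝ^A × ℝ^A → ℝ^A × ℝ^A are continuous B-invariant maps such that f(Z) = F, g(F) = Z, (g ∘ f)|Z = id_Z and (f ∘ g)|F = id_F. Then the set ℳ_{f,g} = ℳ_f ∩ ℳ_g is cofinal and ω-closed in exp_ω A. Moreover, setting Z_{B∪C} = cl((π_{B∪C} × π_{B∪C})(Z)) and F_{B∪C} = cl((π_{B∪C} × π_{B∪C})(F)) (closures taken in ℝ^{B∪C} × ℝ^{B∪C}), for each C ∈ ℳ_{f,g}: (1) f factors through B ∪ C by a map f_{B∪C}; (2) g factors through B ∪ C by a map g_{B∪C}; (3) f_{B∪C}(Z_{B∪C}) = F_{B∪C}; (4) g_{B∪C}(F_{B∪C}) = Z_{B∪C}; (5) (g_{B∪C} ∘ f_{B∪C})|Z_{B∪C} = id; (6) (f_{B∪C} ∘ g_{B∪C})|F_{B∪C} = id. -/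

import Mathlib

open Set Topology

universe u

/-- Restriction of a pair of points of `ℝ^A` to the subproduct `ℝ^C × ℝ^C`. -/
def resP {A : Type u} (C : Set A) (x : (A → ℝ) × (A → ℝ)) : (↥C → ℝ) × (↥C → ℝ) :=
  (fun c => x.1 c, fun c => x.2 c)

/-- `f : ℝ^A × ℝ^A → ℝ^A × ℝ^A` factors through `C ⊆ A` if there is a continuous
`f_C : ℝ^C × ℝ^C → ℝ^C × ℝ^C` with `(π_C × π_C) ∘ f = f_C ∘ (π_C × π_C)`. -/
def FactorsThrough {A : Type u} (f : (A → ℝ) × (A → ℝ) → (A → ℝ) × (A → ℝ))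
    (C : Set A) : Prop :=
  ∃ fC : (↥C → ℝ) × (↥C → ℝ) → (↥C → ℝ) × (↥C → ℝ),
    Continuous fC ∧ ∀ x, resP C (f x) = fC (resP C x)

/-- `f` is `B`-invariant if `(π_B × π_B) ∘ f = π_B × π_B`. -/
def BInvariant {A : Type u} (f : (A → ℝ) × (A → ℝ) → (A → ℝ) × (A → ℝ))
    (B : Set A) : Prop :=
  ∀ x, resP B (f x) = resP B x

/-- `ℳ` is cofinal in `exp_ω A`: every countable subset of `A` is contained in a member. -/
def CofinalInExpOmega {A : Type u} (ℳ : Set (Set A)) : Prop :=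
  ∀ D : Set A, D.Countable → ∃ C ∈ ℳ, D ⊆ C

/-- `ℳ` is ω-closed: the union of any countable increasing chain of members is a member. -/
def OmegaClosed {A : Type u} (ℳ : Set (Set A)) : Prop :=
  ∀ c : ℕ → Set A, (∀ n, c n ∈ ℳ) → (∀ n, c n ⊆ c (n + 1)) → (⋃ n, c n) ∈ ℳ

open MeasureTheory ProbabilityTheory TopologicalSpace

/-- `S` is a nonempty open box in `ℝ^ι` restricting only the coordinates in `s`. -/
def IsOpenBox {ι : Type*} (s : Finset ι) (S : Set (ι → ℝ)) : Prop :=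
  S.Nonempty ∧ ∃ U : ι → Set ℝ, (∀ i ∈ s, IsOpen (U i)) ∧ S = (s : Set ι).pi U

theorem IsOpenBox.isOpen {ι : Type*} {s : Finset ι} {S : Set (ι → ℝ)} (h : IsOpenBox s S) :
    IsOpen S := by
  obtain ⟨-, U, hU, rfl⟩ := h
  exact isOpen_set_pi s.finite_toSet hU

theorem IsOpenBox.measurableSet {ι : Type*} {s : Finset ι} {S : Set (ι → ℝ)}
    (h : IsOpenBox s S) : MeasurableSet S := by
  obtain ⟨-, U, hU, rfl⟩ := h
  exact MeasurableSet.pi s.countable_toSet fun i hi => (hU i hi).measurableSet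

theorem IsOpenBox.mem_of_eqOn {ι : Type*} {s : Finset ι} {S : Set (ι → ℝ)}
    (h : IsOpenBox s S) {x y : ι → ℝ} (hxy : ∀ i ∈ s, x i = y i) (hx : x ∈ S) : y ∈ S := by
  obtain ⟨-, U, hU, rfl⟩ := h
  intro i hi
  rw [← hxy i hi]
  exact hx i hi

theorem IsOpenBox.infinitePi_gaussianReal_pos {ι : Type*} {s : Finset ι} {S : Set (ι → ℝ)}
    (h : IsOpenBox s S) : 0 < Measure.infinitePi (fun _ : ι => gaussianReal 0 1) S := by
  obtain ⟨hne, U, hU, rfl⟩ := h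
  obtain ⟨x, hx⟩ := hne
  have hpos : (gaussianReal 0 1).IsOpenPosMeasure :=
    (gaussianReal_absolutelyContinuous' 0 one_ne_zero).isOpenPosMeasure
  rw [Measure.infinitePi_pi _ fun i hi => (hU i hi).measurableSet]
  exact pos_iff_ne_zero.2 (Finset.prod_ne_zero_iff.2 fun i hi =>
    ((hU i hi).measure_pos _ ⟨x i, hx i hi⟩).ne')

/-- Powers of `ℝ` satisfy the countable chain condition for open boxes. -/
theorem countable_of_pairwiseDisjoint_isOpenBox {ι : Type*} {𝒯 : Set (Set (ι → ℝ))}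
    (hbox : ∀ S ∈ 𝒯, ∃ s, IsOpenBox s S) (hdisj : 𝒯.PairwiseDisjoint id) : 𝒯.Countable := by
  have h := Measure.countable_meas_pos_of_disjoint_iUnion
    (μ := Measure.infinitePi (fun _ : ι => gaussianReal 0 1)) (As := fun S : 𝒯 => (S : Set (ι → ℝ)))
    (fun S => (hbox S S.2).elim fun _ h => h.measurableSet)
    (fun S T hST => hdisj S.2 T.2 (Subtype.coe_injective.ne hST))
  have huniv : {S : 𝒯 | 0 < Measure.infinitePi (fun _ : ι => gaussianReal 0 1)
      (S : Set (ι → ℝ))} = univ :=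
    eq_univ_of_forall fun S => (hbox S S.2).elim fun _ h => h.infinitePi_gaussianReal_pos
  rw [huniv, countable_univ_iff] at h
  exact h

theorem exists_isOpenBox_subset {ι : Type*} {O : Set (ι → ℝ)} (hO : IsOpen O) {x : ι → ℝ}
    (hx : x ∈ O) : ∃ s S, IsOpenBox s S ∧ x ∈ S ∧ S ⊆ O := by
  obtain ⟨_, ⟨U, s, hU, rfl⟩, hxS, hSO⟩ :=
    (isTopologicalBasis_pi fun _ : ι => isTopologicalBasis_opens (α := ℝ)).exists_subset_of_mem_open
      hx hO
  exact ⟨s, _, ⟨⟨x, hxS⟩, U, hU, rfl⟩, hxS, hSO⟩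

/-- Every open subset of `ℝ^ι` has a dense open subset depending on countably many coordinates. -/
theorem exists_dense_open_dependsOn_countable {ι : Type*} {O : Set (ι → ℝ)} (hO : IsOpen O) :
    ∃ (W : Set (ι → ℝ)) (D : Set ι), D.Countable ∧ W ⊆ O ∧ O ⊆ closure W ∧
      ∀ x y, (∀ i ∈ D, x i = y i) → x ∈ W → y ∈ W := by
  obtain ⟨𝒯, h𝒯⟩ := zorn_subset
    {𝒯 : Set (Set (ι → ℝ)) | (∀ S ∈ 𝒯, (∃ s, IsOpenBox s S) ∧ S ⊆ O) ∧ 𝒯.PairwiseDisjoint id}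
    (fun c hc hchain => ⟨⋃₀ c, ⟨fun S ⟨t, ht, hS⟩ => (hc ht).1 S hS,
      (pairwiseDisjoint_sUnion hchain.directedOn).2 fun t ht => (hc ht).2⟩,
      fun t ht => subset_sUnion_of_mem ht⟩)
  have hcount := countable_of_pairwiseDisjoint_isOpenBox (fun S hS => (h𝒯.prop.1 S hS).1)
    h𝒯.prop.2
  choose! s hs using fun S hS => (h𝒯.prop.1 S hS).1
  refine ⟨⋃₀ 𝒯, ⋃ S ∈ 𝒯, (s S : Set ι), hcount.biUnion fun S _ => (s S).countable_toSet,
    sUnion_subset fun S hS => (h𝒯.prop.1 S hS).2, fun x hx => ?_, ?_⟩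
  · rw [mem_closure_iff]
    intro V hV hxV
    by_contra hempty
    obtain ⟨r, S, hS, hxS, hSV⟩ := exists_isOpenBox_subset (hV.inter hO) ⟨hxV, hx⟩
    have hdisj : ∀ T ∈ 𝒯, Disjoint S T := fun T hT => disjoint_left.2 fun y hyS hyT =>
      hempty ⟨y, (hSV hyS).1, T, hT, hyT⟩
    have hmem : S ∈ 𝒯 := h𝒯.le_of_ge (y := insert S 𝒯)
      ⟨by
        rintro T (rfl | hT)
        · exact ⟨⟨r, hS⟩, fun y hy => (hSV hy).2⟩
        · exact h𝒯.prop.1 T hT,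
      h𝒯.prop.2.insert fun T hT _ => hdisj T hT⟩ (subset_insert _ _) (mem_insert _ _)
    exact disjoint_left.1 (hdisj S hmem) hxS hxS
  · rintro x y hxy ⟨S, hS, hxS⟩
    exact ⟨S, hS, (hs S hS).mem_of_eqOn
      (fun i hi => hxy i (mem_biUnion hS (Finset.mem_coe.2 hi))) hxS⟩

/-- A continuous map from a power of `ℝ` to a second countable Hausdorff space depends on
countably many coordinates. -/
theorem Continuous.exists_countable_dependsOn {ι Y : Type*} [TopologicalSpace Y]
    [SecondCountableTopology Y] [T2Space Y] {h : (ι → ℝ) → Y} (hc : Continuous h) :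
    ∃ D : Set ι, D.Countable ∧ DependsOn h D := by
  choose! W D hD hWO hOW hW using fun (U : Set Y) (hU : U ∈ countableBasis Y) =>
    exists_dense_open_dependsOn_countable ((isOpen_of_mem_countableBasis hU).preimage hc)
  refine ⟨⋃ U ∈ countableBasis Y, D U, (countable_countableBasis Y).biUnion hD,
    fun x y hxy => ?_⟩
  by_contra hne
  obtain ⟨U', V, hU', hV, hxU', hyV, hUV⟩ := t2_separation hne
  obtain ⟨U, hU, hxU, hUU'⟩ := (isBasis_countableBasis Y).exists_subset_of_mem_open hxU' hU'
  have hy : y ∈ closure (W U) := by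
    have hx := mem_closure_iff.1 (hOW U hU hxU)
    refine mem_closure_iff.2 fun O hO hyO => ?_
    obtain ⟨w, hwO, hwW⟩ := hx ((fun w => w + (y - x)) ⁻¹' O)
      (hO.preimage (continuous_id.add continuous_const)) (by simpa using hyO)
    refine ⟨w + (y - x), hwO, hW U hU w _ (fun i hi => ?_) hwW⟩
    simp [hxy i (mem_biUnion hU hi)]
  obtain ⟨w, hwV, hwW⟩ := mem_closure_iff.1 hy (h ⁻¹' V) (hV.preimage hc) hyV
  exact disjoint_left.1 hUV (hUU' (hWO U hU hwW)) hwV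

theorem resP_eq_iff {A : Type*} {C : Set A} {x y : (A → ℝ) × (A → ℝ)} :
    resP C x = resP C y ↔ ∀ a ∈ C, x.1 a = y.1 a ∧ x.2 a = y.2 a := by
  simp [resP, Prod.ext_iff, funext_iff, forall_and]

theorem continuous_resP {A : Type*} (C : Set A) : Continuous (resP C) := by
  unfold resP
  fun_prop

theorem factorsThrough_iff {A : Type*} {f : (A → ℝ) × (A → ℝ) → (A → ℝ) × (A → ℝ)}
    (hf : Continuous f) {C : Set A} :
    FactorsThrough f C ↔ ∀ x y, resP C x = resP C y → resP C (f x) = resP C (f y) := by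
  classical
  refine ⟨fun ⟨fC, _, h⟩ x y hxy => by rw [h, h, hxy], fun h => ?_⟩
  let e : (C → ℝ) × (C → ℝ) → (A → ℝ) × (A → ℝ) := fun p =>
    (fun a => if ha : a ∈ C then p.1 ⟨a, ha⟩ else 0, fun a => if ha : a ∈ C then p.2 ⟨a, ha⟩ else 0)
  have he : Continuous e := by
    refine Continuous.prodMk (continuous_pi fun a => ?_) (continuous_pi fun a => ?_) <;>
    · by_cases ha : a ∈ C <;> simp only [ha, dite_true, dite_false] <;> fun_prop
  refine ⟨fun p => resP C (f (e p)), (continuous_resP C).comp (hf.comp he), fun x => h _ _ ?_⟩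
  rw [resP_eq_iff]
  intro a ha
  simp [e, ha, resP]

theorem FactorsThrough.iUnion {A : Type*} {f : (A → ℝ) × (A → ℝ) → (A → ℝ) × (A → ℝ)}
    (hf : Continuous f) {κ : Sort*} {c : κ → Set A} (h : ∀ k, FactorsThrough f (c k)) :
    FactorsThrough f (⋃ k, c k) := by
  rw [factorsThrough_iff hf]
  intro x y hxy
  rw [resP_eq_iff] at hxy ⊢
  intro a ha
  obtain ⟨k, hk⟩ := mem_iUnion.1 ha
  exact resP_eq_iff.1 ((factorsThrough_iff hf).1 (h k) x y
    (resP_eq_iff.2 fun b hb => hxy b (mem_iUnion_of_mem k hb))) a hk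

theorem BInvariant.factorsThrough {A : Type*} {f : (A → ℝ) × (A → ℝ) → (A → ℝ) × (A → ℝ)}
    (hf : Continuous f) {B : Set A} (h : BInvariant f B) : FactorsThrough f B :=
  (factorsThrough_iff hf).2 fun x y hxy => by rw [h, h, hxy]

theorem FactorsThrough.union {A : Type*} {f : (A → ℝ) × (A → ℝ) → (A → ℝ) × (A → ℝ)}
    (hf : Continuous f) {B C : Set A} (hB : FactorsThrough f B) (hC : FactorsThrough f C) :
    FactorsThrough f (B ∪ C) := by
  rw [union_eq_iUnion]
  exact FactorsThrough.iUnion hf fun b => by cases b <;> assumption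

theorem exists_countable_coordinate_dependence {A : Type*}
    {f : (A → ℝ) × (A → ℝ) → (A → ℝ) × (A → ℝ)} (hf : Continuous f) (a : A) :
    ∃ D : Set A, D.Countable ∧
      ∀ x y, resP D x = resP D y → (f x).1 a = (f y).1 a ∧ (f x).2 a = (f y).2 a := by
  have hc : Continuous fun u : A ⊕ A → ℝ =>
      ((f (u ∘ Sum.inl, u ∘ Sum.inr)).1 a, (f (u ∘ Sum.inl, u ∘ Sum.inr)).2 a) := by
    have : Continuous fun u : A ⊕ A → ℝ => f (u ∘ Sum.inl, u ∘ Sum.inr) :=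
      hf.comp (by unfold Function.comp; fun_prop)
    fun_prop
  obtain ⟨E, hE, hdep⟩ := hc.exists_countable_dependsOn
  refine ⟨Sum.elim id id '' E, hE.image _, fun x y hxy => ?_⟩
  rw [resP_eq_iff] at hxy
  have := hdep (x := Sum.elim x.1 x.2) (y := Sum.elim y.1 y.2) (by
    rintro (b | b) hb
    · exact (hxy b ⟨_, hb, rfl⟩).1
    · exact (hxy b ⟨_, hb, rfl⟩).2)
  simpa [Prod.ext_iff] using this

/-- Every countable set is contained in a countable set closed under a given operation with
countable values. -/
theorem exists_countable_superset_closed {A : Type*} {T : A → Set A} (hT : ∀ a, (T a).Countable)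
    {D : Set A} (hD : D.Countable) :
    ∃ C : Set A, C.Countable ∧ D ⊆ C ∧ ∀ a ∈ C, T a ⊆ C := by
  let E : ℕ → Set A := fun n => (fun s => ⋃ a ∈ s, T a)^[n] D
  have hE : ∀ n, E (n + 1) = ⋃ a ∈ E n, T a := fun n => Function.iterate_succ_apply' _ _ _
  refine ⟨⋃ n, E n, countable_iUnion fun n => ?_, subset_iUnion E 0, fun a ha b hb => ?_⟩
  · induction n with
    | zero => exact hD
    | succ n ih => rw [hE]; exact ih.biUnion fun a _ => hT a
  · obtain ⟨n, hn⟩ := mem_iUnion.1 ha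
    exact mem_iUnion.2 ⟨n + 1, hE n ▸ mem_biUnion hn hb⟩

theorem factorsThrough_of_coordinate_dependence {A : Type*}
    {f : (A → ℝ) × (A → ℝ) → (A → ℝ) × (A → ℝ)} (hf : Continuous f) {T : A → Set A}
    (hT : ∀ a x y, resP (T a) x = resP (T a) y → (f x).1 a = (f y).1 a ∧ (f x).2 a = (f y).2 a)
    {C : Set A} (hC : ∀ a ∈ C, T a ⊆ C) : FactorsThrough f C := by
  rw [factorsThrough_iff hf]
  intro x y hxy
  rw [resP_eq_iff] at hxy ⊢
  exact fun a ha => hT a x y (resP_eq_iff.2 fun b hb => hxy b (hC a ha hb))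

theorem mapsTo_closure_resP {A : Type*} {f : (A → ℝ) × (A → ℝ) → (A → ℝ) × (A → ℝ)}
    {Z F : Set ((A → ℝ) × (A → ℝ))} (hfZ : f '' Z = F) {C : Set A}
    {fC : (C → ℝ) × (C → ℝ) → (C → ℝ) × (C → ℝ)} (hc : Continuous fC)
    (h : ∀ x, resP C (f x) = fC (resP C x)) :
    MapsTo fC (closure (resP C '' Z)) (closure (resP C '' F)) := by
  refine MapsTo.closure ?_ hc
  rintro _ ⟨z, hz, rfl⟩
  exact ⟨f z, hfZ ▸ mem_image_of_mem f hz, h z⟩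

theorem leftInvOn_closure_resP {A : Type*} {f g : (A → ℝ) × (A → ℝ) → (A → ℝ) × (A → ℝ)}
    {Z : Set ((A → ℝ) × (A → ℝ))} (hgf : ∀ z ∈ Z, g (f z) = z) {C : Set A}
    {fC gC : (C → ℝ) × (C → ℝ) → (C → ℝ) × (C → ℝ)} (hfc : Continuous fC) (hgc : Continuous gC)
    (hf : ∀ x, resP C (f x) = fC (resP C x)) (hg : ∀ x, resP C (g x) = gC (resP C x)) :
    LeftInvOn gC fC (closure (resP C '' Z)) := by
  have h : EqOn (gC ∘ fC) id (resP C '' Z) := by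
    rintro _ ⟨z, hz, rfl⟩
    simp [← hf, ← hg, hgf z hz]
  exact h.closure (hgc.comp hfc) continuous_id

/-- For `B`-invariant maps `f, g` interchanging the closed sets `Z, F` as mutually inverse
homeomorphisms on them, `ℳ_{f,g} = ℳ_f ∩ ℳ_g` is cofinal and ω-closed in `exp_ω A`, and for
each `C ∈ ℳ_{f,g}` the factorizations through `B ∪ C` interchange the closures of the
projections of `Z` and `F` as mutually inverse homeomorphisms on them. -/
theorem factorization_pair_properties
    (A : Type u) (hA : Cardinal.aleph0 < Cardinal.mk A) (B : Set A)
    (Z F : Set ((A → ℝ) × (A → ℝ))) (hZcl : IsClosed Z) (hFcl : IsClosed F)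
    (f g : (A → ℝ) × (A → ℝ) → (A → ℝ) × (A → ℝ))
    (hfc : Continuous f) (hgc : Continuous g)
    (hfB : BInvariant f B) (hgB : BInvariant g B)
    (hfZ : f '' Z = F) (hgF : g '' F = Z)
    (hgf : ∀ z ∈ Z, g (f z) = z) (hfg : ∀ y ∈ F, f (g y) = y) :
    CofinalInExpOmega
      {C : Set A | C.Countable ∧ FactorsThrough f C ∧ FactorsThrough g C} ∧
    OmegaClosed
      {C : Set A | C.Countable ∧ FactorsThrough f C ∧ FactorsThrough g C} ∧
    ∀ C : Set A, C ∈ {C : Set A | C.Countable ∧ FactorsThrough f C ∧ FactorsThrough g C} →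
      ∃ (fBC gBC : (↥(B ∪ C) → ℝ) × (↥(B ∪ C) → ℝ) → (↥(B ∪ C) → ℝ) × (↥(B ∪ C) → ℝ)),
        Continuous fBC ∧ Continuous gBC ∧
        (∀ x, resP (B ∪ C) (f x) = fBC (resP (B ∪ C) x)) ∧
        (∀ x, resP (B ∪ C) (g x) = gBC (resP (B ∪ C) x)) ∧
        fBC '' closure (resP (B ∪ C) '' Z) = closure (resP (B ∪ C) '' F) ∧
        gBC '' closure (resP (B ∪ C) '' F) = closure (resP (B ∪ C) '' Z) ∧
        (∀ z ∈ closure (resP (B ∪ C) '' Z), gBC (fBC z) = z) ∧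
        (∀ y ∈ closure (resP (B ∪ C) '' F), fBC (gBC y) = y) := by
  refine ⟨fun D hD => ?_, fun c hc _ => ⟨countable_iUnion fun n => (hc n).1,
    FactorsThrough.iUnion hfc fun n => (hc n).2.1,
    FactorsThrough.iUnion hgc fun n => (hc n).2.2⟩, fun C hC => ?_⟩
  · choose Tf hTf hf using exists_countable_coordinate_dependence hfc
    choose Tg hTg hg using exists_countable_coordinate_dependence hgc
    obtain ⟨C, hC, hDC, hcl⟩ := exists_countable_superset_closed
      (fun a => (hTf a).union (hTg a)) hD
    exact ⟨C, ⟨hC,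
      factorsThrough_of_coordinate_dependence hfc hf fun a ha => subset_union_left.trans (hcl a ha),
      factorsThrough_of_coordinate_dependence hgc hg fun a ha =>
        subset_union_right.trans (hcl a ha)⟩, hDC⟩
  · obtain ⟨fBC, hfBC, hf⟩ := (hfB.factorsThrough hfc).union hfc hC.2.1
    obtain ⟨gBC, hgBC, hg⟩ := (hgB.factorsThrough hgc).union hgc hC.2.2
    have hmf := mapsTo_closure_resP hfZ hfBC hf
    have hmg := mapsTo_closure_resP hgF hgBC hg
    have hl := leftInvOn_closure_resP hgf hfBC hgBC hf hg
    have hr := leftInvOn_closure_resP hfg hgBC hfBC hg hf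
    exact ⟨fBC, gBC, hfBC, hgBC, hf, hg, (hr.surjOn hmg).image_eq_of_mapsTo hmf,
      (hl.surjOn hmf).image_eq_of_mapsTo hmg, hl, hr⟩
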